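/- arXiv:1905.07473 — 3 statements merged into one kernel-verified Lean document; each statement's English description precedes it below -/
import Mathlib

section
/- Let (Ω, μ) be a probability space, H a real normed vector space, T a natural number, M ≥ 0, β ∈ (0,1), and τ ≤ T a natural number. For k = 0,…,T let ψ_k : Ω → H be Bochner-integrable and φ_k : Ω → ℝ be nonnegative and integrable, with ‖ψ_k(ω)‖ ≤ M·φ_k(ω) for all ω and all k ≥ 1, and suppose E[φ_{k+1}] ≤ β·E[φ_k] for all k with τ ≤ k < T. Define ĝ_K = Σ_{k=0}^K ψ_k and g = E[ĝ_T]. Then for every K ≤ T: ‖E[ĝ_K] − g‖ ≤ ℰ(K), where ℰ(K) = M·(Σ_{k=K+1}^{τ−1} E[φ_k] + E[φ_τ]/(1−β)) if K < τ, and ℰ(K) = M·E[φ_τ]·β^{K−τ}/(1−β) if K ≥ τ. -/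
open MeasureTheory

/-- Absolute-bias half of Theorem 1 (Bias Bound): under the geometric decay
assumption (A-1) on the expected gradient norms `φ_k` and the bound
`‖ψ_k‖ ≤ M·φ_k` (from A-2), the bias of the truncated estimator
`ĝ_K = Σ_{k=0}^K ψ_k` relative to `g = E[ĝ_T]` satisfies
`‖E[ĝ_K] − g‖ ≤ ℰ(K)`. -/
theorem tbptt_absolute_bias_bound
    {Ω : Type*} [MeasurableSpace Ω] (μ : Measure Ω) [IsProbabilityMeasure μ]
    {H : Type*} [NormedAddCommGroup H] [NormedSpace ℝ H]
    (T : ℕ) (M : ℝ) (hM : 0 ≤ M) (β : ℝ) (hβ : β ∈ Set.Ioo (0 : ℝ) 1)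
    (τ : ℕ) (hτT : τ ≤ T)
    (ψ : ℕ → Ω → H) (φ : ℕ → Ω → ℝ)
    (hψ_int : ∀ k, k ≤ T → Integrable (ψ k) μ)
    (hφ_nonneg : ∀ k, k ≤ T → ∀ ω, 0 ≤ φ k ω)
    (hφ_int : ∀ k, k ≤ T → Integrable (φ k) μ)
    (hψφ : ∀ k, 1 ≤ k → k ≤ T → ∀ ω, ‖ψ k ω‖ ≤ M * φ k ω)
    (hdecay : ∀ k, τ ≤ k → k < T →
      (∫ ω, φ (k + 1) ω ∂μ) ≤ β * ∫ ω, φ k ω ∂μ)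
    (ghat : ℕ → Ω → H) (hghat : ∀ K ω, ghat K ω = ∑ k ∈ Finset.range (K + 1), ψ k ω)
    (g : H) (hg : g = ∫ ω, ghat T ω ∂μ)
    (ℰ : ℕ → ℝ)
    (hℰ : ∀ K, ℰ K =
      if K < τ then
        M * ((∑ k ∈ Finset.Icc (K + 1) (τ - 1), ∫ ω, φ k ω ∂μ) +
          (∫ ω, φ τ ω ∂μ) / (1 - β))
      else
        M * (∫ ω, φ τ ω ∂μ) * β ^ (K - τ) / (1 - β)) :
    ∀ K, K ≤ T → ‖(∫ ω, ghat K ω ∂μ) - g‖ ≤ ℰ K := by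
  obtain ⟨hβ0, hβ1⟩ := hβ
  have h1β : 0 < 1 - β := by linarith
  set e : ℕ → ℝ := fun k => ∫ ω, φ k ω ∂μ with he
  have he0 : ∀ k, k ≤ T → 0 ≤ e k := fun k hk => integral_nonneg (hφ_nonneg k hk)
  have hG : ∀ K, K ≤ T → ∫ ω, ghat K ω ∂μ = ∑ k ∈ Finset.range (K + 1), ∫ ω, ψ k ω ∂μ := by
    intro K hK
    simp only [hghat]
    apply integral_finsetSum
    intro i hi
    exact hψ_int i (by have := Finset.mem_range.1 hi; omega)
  have hψe : ∀ k, 1 ≤ k → k ≤ T → ‖∫ ω, ψ k ω ∂μ‖ ≤ M * e k := by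
    intro k h1 hk
    have := norm_integral_le_of_norm_le ((hφ_int k hk).const_mul M)
      (Filter.Eventually.of_forall (hψφ k h1 hk))
    rwa [integral_const_mul] at this
  have hgeo : ∀ n, τ + n ≤ T → e (τ + n) ≤ e τ * β ^ n := by
    intro n
    induction n with
    | zero => intro _; simp
    | succ n ih =>
      intro hn
      have h1 := hdecay (τ + n) (by omega) (by omega)
      have h2 := mul_le_mul_of_nonneg_left (ih (by omega)) hβ0.le
      calc e (τ + (n + 1)) ≤ β * e (τ + n) := h1
        _ ≤ _ := h2
        _ = _ := by ring
  have key : ∀ n K, K + n = T → ‖(∫ ω, ghat K ω ∂μ) - g‖ ≤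
      M * ((∑ k ∈ Finset.Ico (K + 1) τ, e k) + e τ * β ^ (K + 1 - τ) / (1 - β)) := by
    intro n
    induction n with
    | zero =>
      intro K hK
      have hKT : K = T := by omega
      subst hKT
      rw [hg, sub_self, norm_zero, Finset.Ico_eq_empty (by omega), Finset.sum_empty]
      have := he0 τ hτT
      positivity
    | succ n ih =>
      intro K hK
      have h1 := ih (K + 1) (by omega)
      have h2 := hψe (K + 1) (by omega) (by omega)
      have h3 : (∫ ω, ghat K ω ∂μ) - g
          = ((∫ ω, ghat (K + 1) ω ∂μ) - g) - ∫ ω, ψ (K + 1) ω ∂μ := by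
        rw [hG K (by omega), hG (K + 1) (by omega), Finset.sum_range_succ _ (K + 1)]
        abel
      rw [h3]
      refine (norm_sub_le _ _).trans ((add_le_add h1 h2).trans ?_)
      rw [← mul_add]
      apply mul_le_mul_of_nonneg_left _ hM
      by_cases hlt : K + 1 < τ
      · rw [Finset.sum_eq_sum_Ico_succ_bot hlt, show K + 1 + 1 - τ = 0 by omega,
          show K + 1 - τ = 0 by omega]
        linarith
      · obtain ⟨m, hm⟩ := Nat.exists_eq_add_of_le (not_lt.1 hlt)
        have h4 := hgeo m (by omega)
        rw [Finset.Ico_eq_empty (by omega), Finset.Ico_eq_empty (by omega), hm,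
          show τ + m + 1 - τ = m + 1 by omega, show τ + m - τ = m by omega]
        have h5 : e τ * β ^ (m + 1) / (1 - β) + e τ * β ^ m = e τ * β ^ m / (1 - β) := by
          field_simp
          ring
        simp only [Finset.sum_empty]
        linarith
  intro K hK
  refine (key (T - K) K (by omega)).trans ?_
  rw [hℰ]
  split_ifs with h
  · rw [show K + 1 - τ = 0 by omega,
      show Finset.Icc (K + 1) (τ - 1) = Finset.Ico (K + 1) τ by
        ext x; simp only [Finset.mem_Icc, Finset.mem_Ico]; omega]
    simp [he]
  · rw [Finset.Ico_eq_empty (by omega), Finset.sum_empty, zero_add,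
      show K + 1 - τ = (K - τ) + 1 by omega, mul_assoc, mul_div_assoc M]
    apply mul_le_mul_of_nonneg_left _ hM
    have h6 : β ^ (K - τ + 1) ≤ β ^ (K - τ) := pow_le_pow_of_le_one hβ0.le hβ1.le (by omega)
    have h7 := mul_le_mul_of_nonneg_left h6 (he0 τ hτT)
    exact div_le_div_of_nonneg_right h7 h1β.le
end

section
/- Let (Ω, μ) be a probability space, H a real normed vector space, T a natural number, M ≥ 0, β ∈ (0,1), and τ ≤ T a natural number. For k = 0,…,T let ψ_k : Ω → H be Bochner-integrable and φ_k : Ω → ℝ be nonnegative and integrable, with ‖ψ_k(ω)‖ ≤ M·φ_k(ω) for all ω and all k ≥ 1, and suppose E[φ_{k+1}] ≤ β·E[φ_k] for all k with τ ≤ k < T. Define ĝ_K = Σ_{k=0}^K ψ_k, g = E[ĝ_T], and ℰ(K) = M·(Σ_{k=K+1}^{τ−1} E[φ_k] + E[φ_τ]/(1−β)) if K < τ, ℰ(K) = M·E[φ_τ]·β^{K−τ}/(1−β) if K ≥ τ. If for some K ≤ T the quantity D_K := max_{k ≤ K} (‖E[ĝ_k]‖ − ℰ(k)) is strictly positive,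 then g ≠ 0 and the relative bias satisfies ‖E[ĝ_K] − g‖ / ‖g‖ ≤ ℰ(K) / D_K. -/
open MeasureTheory

/-- Relative-bias half of Theorem 1 (Bias Bound): under the geometric decay
assumption (A-1) and the bound `‖ψ_k‖ ≤ M·φ_k` (from A-2), if the quantity
`D_K = max_{k ≤ K} (‖E[ĝ_k]‖ − ℰ(k))` is strictly positive, then the full
gradient `g = E[ĝ_T]` is nonzero and the relative bias of the truncated
estimator satisfies `‖E[ĝ_K] − g‖/‖g‖ ≤ ℰ(K)/D_K`. -/
theorem tbptt_relative_bias_bound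
    {Ω : Type*} [MeasurableSpace Ω] (μ : Measure Ω) [IsProbabilityMeasure μ]
    {H : Type*} [NormedAddCommGroup H] [NormedSpace ℝ H]
    (T : ℕ) (M : ℝ) (hM : 0 ≤ M) (β : ℝ) (hβ : β ∈ Set.Ioo (0 : ℝ) 1)
    (τ : ℕ) (hτT : τ ≤ T)
    (ψ : ℕ → Ω → H) (φ : ℕ → Ω → ℝ)
    (hψ_int : ∀ k, k ≤ T → Integrable (ψ k) μ)
    (hφ_nonneg : ∀ k, k ≤ T → ∀ ω, 0 ≤ φ k ω)
    (hφ_int : ∀ k, k ≤ T → Integrable (φ k) μ)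
    (hψφ : ∀ k, 1 ≤ k → k ≤ T → ∀ ω, ‖ψ k ω‖ ≤ M * φ k ω)
    (hdecay : ∀ k, τ ≤ k → k < T →
      (∫ ω, φ (k + 1) ω ∂μ) ≤ β * ∫ ω, φ k ω ∂μ)
    (ghat : ℕ → Ω → H) (hghat : ∀ K ω, ghat K ω = ∑ k ∈ Finset.range (K + 1), ψ k ω)
    (g : H) (hg : g = ∫ ω, ghat T ω ∂μ)
    (ℰ : ℕ → ℝ)
    (hℰ : ∀ K, ℰ K =
      if K < τ then
        M * ((∑ k ∈ Finset.Icc (K + 1) (τ - 1), ∫ ω, φ k ω ∂μ) +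
          (∫ ω, φ τ ω ∂μ) / (1 - β))
      else
        M * (∫ ω, φ τ ω ∂μ) * β ^ (K - τ) / (1 - β))
    (K : ℕ) (hKT : K ≤ T)
    (D : ℝ)
    (hD : D = (Finset.range (K + 1)).sup' (by simp)
      (fun k => ‖∫ ω, ghat k ω ∂μ‖ - ℰ k))
    (hDpos : 0 < D) :
    g ≠ 0 ∧ ‖(∫ ω, ghat K ω ∂μ) - g‖ / ‖g‖ ≤ ℰ K / D := by
  obtain ⟨hβ0, hβ1⟩ := hβ
  have h1β : 0 < 1 - β := by linarith
  have hp0 : ∀ k, k ≤ T → 0 ≤ ∫ ω, φ k ω ∂μ := fun k hk => integral_nonneg (hφ_nonneg k hk)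
  have ha : ∀ k, 1 ≤ k → k ≤ T → ‖∫ ω, ψ k ω ∂μ‖ ≤ M * ∫ ω, φ k ω ∂μ := by
    intro k h1 hk
    rw [← integral_const_mul]
    exact norm_integral_le_of_norm_le ((hφ_int k hk).const_mul M)
      (Filter.Eventually.of_forall (hψφ k h1 hk))
  have hG : ∀ k, k ≤ T → ∫ ω, ghat k ω ∂μ = ∑ j ∈ Finset.range (k + 1), ∫ ω, ψ j ω ∂μ := by
    intro k hk
    simp_rw [hghat]
    apply integral_finset_sum
    intro j hj
    exact hψ_int j (by have := Finset.mem_range.1 hj; omega)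
  generalize hp : (fun k => ∫ ω, φ k ω ∂μ) = p at *
  have hpk : ∀ k, ∫ ω, φ k ω ∂μ = p k := fun k => congrFun hp k
  simp only [hpk] at *
  have hdec : ∀ n, τ + n ≤ T → p (τ + n) ≤ p τ * β ^ n := by
    intro n
    induction n with
    | zero => intro _; simp
    | succ n ih =>
      intro h
      have h1 := hdecay (τ + n) (by omega) (by omega)
      have h2 := mul_le_mul_of_nonneg_left (ih (by omega)) hβ0.le
      calc p (τ + (n + 1)) ≤ β * p (τ + n) := h1
        _ ≤ β * (p τ * β ^ n) := h2
        _ = p τ * β ^ (n + 1) := by ring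
  have hpτ := hp0 τ hτT
  -- sharp tail bound past `τ`
  have tail : ∀ n k, k + n = T → τ ≤ k + 1 →
      ‖(∫ ω, ghat k ω ∂μ) - g‖ ≤ M * p τ * β ^ (k + 1 - τ) / (1 - β) := by
    intro n
    induction n with
    | zero =>
      intro k hk _
      obtain rfl : k = T := by omega
      rw [hg, sub_self, norm_zero]
      positivity
    | succ n ih =>
      intro k hk hτk
      have h1 := ih (k + 1) (by omega) (by omega)
      have h2 := ha (k + 1) (by omega) (by omega)
      have h3 := hdec (k + 1 - τ) (by omega)
      rw [show τ + (k + 1 - τ) = k + 1 by omega] at h3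
      rw [show k + 1 + 1 - τ = (k + 1 - τ) + 1 by omega] at h1
      have h4 := mul_le_mul_of_nonneg_left h3 hM
      have e : (∫ ω, ghat k ω ∂μ) - g
          = ((∫ ω, ghat (k + 1) ω ∂μ) - g) - ∫ ω, ψ (k + 1) ω ∂μ := by
        rw [hG k (by omega), hG (k + 1) (by omega), Finset.sum_range_succ _ (k + 1)]
        abel
      rw [e]
      refine (norm_sub_le _ _).trans ?_
      have e2 : M * p τ * β ^ (k + 1 - τ) / (1 - β)
          = M * p τ * β ^ (k + 1 - τ + 1) / (1 - β) + M * (p τ * β ^ (k + 1 - τ)) := by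
        field_simp
        ring
      linarith
  have head : ∀ n k, k + 1 + n = τ →
      ‖(∫ ω, ghat k ω ∂μ) - g‖ ≤ M * ((∑ j ∈ Finset.Icc (k + 1) (τ - 1), p j) + p τ / (1 - β)) := by
    intro n
    induction n with
    | zero =>
      intro k hk
      have h := tail (T - k) k (by omega) (by omega)
      rw [show k + 1 - τ = 0 by omega] at h
      rw [Finset.Icc_eq_empty (by omega)]
      simpa [mul_div_assoc] using h
    | succ n ih =>
      intro k hk
      have h1 := ih (k + 1) (by omega)
      have h2 := ha (k + 1) (by omega) (by omega)
      have e : (∫ ω, ghat k ω ∂μ) - g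
          = ((∫ ω, ghat (k + 1) ω ∂μ) - g) - ∫ ω, ψ (k + 1) ω ∂μ := by
        rw [hG k (by omega), hG (k + 1) (by omega), Finset.sum_range_succ _ (k + 1)]
        abel
      rw [e]
      refine (norm_sub_le _ _).trans ?_
      have e3 : ∑ j ∈ Finset.Icc (k + 1) (τ - 1), p j
          = p (k + 1) + ∑ j ∈ Finset.Icc (k + 1 + 1) (τ - 1), p j := by
        rw [← Finset.insert_Icc_add_one_left_eq_Icc (by omega : k + 1 ≤ τ - 1),
          Finset.sum_insert (by simp)]
      rw [e3]
      linarith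
  have bias : ∀ k, k ≤ T → ‖(∫ ω, ghat k ω ∂μ) - g‖ ≤ ℰ k := by
    intro k hk
    rw [hℰ]
    split_ifs with h
    · exact head (τ - (k + 1)) k (by omega)
    · refine (tail (T - k) k (by omega) (by omega)).trans ?_
      have : β ^ (k + 1 - τ) ≤ β ^ (k - τ) :=
        pow_le_pow_of_le_one hβ0.le hβ1.le (by omega)
      gcongr
  have hDg : D ≤ ‖g‖ := by
    rw [hD]
    apply Finset.sup'_le
    intro k hk
    have h1 := bias k (by have := Finset.mem_range.1 hk; omega)
    have h2 := norm_sub_norm_le (∫ ω, ghat k ω ∂μ) g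
    linarith
  have hgpos : 0 < ‖g‖ := hDpos.trans_le hDg
  refine ⟨norm_pos_iff.1 hgpos, ?_⟩
  have hb := bias K hKT
  exact div_le_div₀ ((norm_nonneg _).trans hb) hb hDpos hDg
end

section
/- Let H be a real inner product space and ℒ : H → ℝ be differentiable with gradient g : H → H satisfying ‖g(θ) − g(θ')‖ ≤ L·‖θ − θ'‖ for all θ, θ' (L-Lipschitz gradient), and suppose ℒ is bounded below by ℒ*. Let δ ∈ [0,1), σ ≥ 0, and let (Ω₀, μ₀) be a probability space with a jointly measurable map G : H × Ω₀ → H such that for every θ ∈ H: G(θ, ·) is Bochner-integrable with E[‖G(θ, ·)‖²] < ∞, ‖E[G(θ, ·)] − g(θ)‖ ≤ δ·‖g(θ)‖, and E[‖G(θ, ·) − E[G(θ, ·)]‖²] ≤ σ². On the N-fold product probability space Ω = Ω₀^N with the product measure, fix θ₁ ∈ H and stepsizes 0 < γ_n ≤ (1 − δ)/(L·(1 + δ)²), and define the SGD iterates θ_{n+1}(ω) = θ_n(ω) − γ_n·G(θ_n(ω), ω_n) for n = 1,…,N. Then E[ min_{1 ≤ n ≤ N+1} ‖g(θ_n)‖²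 ] ≤ (2·(ℒ(θ₁) − ℒ*) + L·σ²·Σ_{n=1}^N γ_n²) / ((1 − δ)·Σ_{n=1}^N γ_n). -/
open MeasureTheory

theorem sgd_descent {H : Type*} [NormedAddCommGroup H] [InnerProductSpace ℝ H]
    (ℒ : H → ℝ) (g : H → H) (L : ℝ)
    (hgrad : ∀ θ, HasFDerivAt ℒ ((InnerProductSpace.toDualMap ℝ H) (g θ)) θ)
    (hLip : ∀ θ θ', ‖g θ - g θ'‖ ≤ L * ‖θ - θ'‖) (θ v : H) :
    ℒ (θ + v) ≤ ℒ θ + inner ℝ (g θ) v + L / 2 * ‖v‖ ^ 2 := by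
  have hd : ∀ t : ℝ, HasDerivAt
      (fun t : ℝ => ℒ (θ + t • v) - t * inner ℝ (g θ) v - L / 2 * ‖v‖ ^ 2 * t ^ 2)
      (inner ℝ (g (θ + t • v)) v - inner ℝ (g θ) v - L * ‖v‖ ^ 2 * t) t := by
    intro t
    have h1 : HasDerivAt (fun t : ℝ => θ + t • v) v t := by
      simpa using ((hasDerivAt_id t).smul_const v).const_add θ
    have h2 := (hgrad (θ + t • v)).comp_hasDerivAt t h1
    have h3 := (hasDerivAt_id t).mul_const (inner ℝ (g θ) v)
    have h4 := (hasDerivAt_pow 2 t).const_mul (L / 2 * ‖v‖ ^ 2)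
    have h5 := (h2.sub h3).sub h4
    refine HasDerivAt.congr_deriv h5 ?_
    simp [InnerProductSpace.toDualMap_apply_apply]
    ring
  have hanti : AntitoneOn
      (fun t : ℝ => ℒ (θ + t • v) - t * inner ℝ (g θ) v - L / 2 * ‖v‖ ^ 2 * t ^ 2)
      (Set.Icc 0 1) := by
    apply antitoneOn_of_deriv_nonpos (convex_Icc 0 1)
    · exact fun t _ => (hd t).continuousAt.continuousWithinAt
    · exact fun t _ => (hd t).differentiableAt.differentiableWithinAt
    · intro t ht
      rw [interior_Icc] at ht
      rw [(hd t).deriv, ← inner_sub_left]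
      have h1 := real_inner_le_norm (g (θ + t • v) - g θ) v
      have h2 := hLip (θ + t • v) θ
      rw [add_sub_cancel_left, norm_smul, Real.norm_eq_abs, abs_of_pos ht.1] at h2
      have h3 := mul_le_mul_of_nonneg_right h2 (norm_nonneg v)
      nlinarith
  have h := hanti (Set.left_mem_Icc.2 zero_le_one) (Set.right_mem_Icc.2 zero_le_one) zero_le_one
  simp at h
  linarith

theorem sgd_one_step {H : Type*} [NormedAddCommGroup H] [InnerProductSpace ℝ H] [CompleteSpace H]
    (L δ σ γ : ℝ) (hL : 0 < L) (hδ : δ ∈ Set.Ico (0 : ℝ) 1)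
    {Ω₀ : Type*} [MeasurableSpace Ω₀] (μ₀ : Measure Ω₀) [IsProbabilityMeasure μ₀]
    (X : Ω₀ → H) (a : H)
    (hX : Integrable X μ₀) (hX2 : Integrable (fun ω => ‖X ω‖ ^ 2) μ₀)
    (hbias : ‖(∫ ω, X ω ∂μ₀) - a‖ ≤ δ * ‖a‖)
    (hvar : (∫ ω, ‖X ω - ∫ ω', X ω' ∂μ₀‖ ^ 2 ∂μ₀) ≤ σ ^ 2)
    (hγ : 0 < γ) (hγL : γ * (L * (1 + δ) ^ 2) ≤ 1 - δ) :
    Integrable (fun ω => - 2 * γ * inner ℝ a (X ω) + L * γ ^ 2 * ‖X ω‖ ^ 2) μ₀ ∧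
    ∫ ω, (- 2 * γ * inner ℝ a (X ω) + L * γ ^ 2 * ‖X ω‖ ^ 2) ∂μ₀ ≤
      - ((1 - δ) * (γ * ‖a‖ ^ 2)) + L * σ ^ 2 * γ ^ 2 := by
  obtain ⟨hδ0, hδ1⟩ := hδ
  have hi : ∀ c : H, Integrable (fun ω => inner ℝ c (X ω)) μ₀ := fun c => hX.const_inner c
  have hI1 := (hi a).const_mul (- 2 * γ)
  have hI2 := hX2.const_mul (L * γ ^ 2)
  refine ⟨hI1.add hI2, ?_⟩
  rw [integral_add hI1 hI2, integral_const_mul, integral_const_mul, integral_inner hX]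
  set m := ∫ ω, X ω ∂μ₀ with hm
  have hv : (∫ ω, ‖X ω - m‖ ^ 2 ∂μ₀) = (∫ ω, ‖X ω‖ ^ 2 ∂μ₀) - ‖m‖ ^ 2 := by
    have h1 : ∀ ω, ‖X ω - m‖ ^ 2 = ‖X ω‖ ^ 2 - 2 * inner ℝ m (X ω) + ‖m‖ ^ 2 := by
      intro ω
      rw [norm_sub_sq_real, real_inner_comm]
    simp_rw [h1]
    have h2 : Integrable (fun ω => ‖X ω‖ ^ 2 - 2 * inner ℝ m (X ω)) μ₀ :=
      hX2.sub ((hi m).const_mul 2)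
    rw [integral_add h2 (integrable_const _),
      integral_sub hX2 ((hi m).const_mul 2), integral_const_mul, integral_inner hX, ← hm,
      real_inner_self_eq_norm_sq]
    simp
    ring
  rw [hv] at hvar
  have hnm : ‖m‖ ≤ (1 + δ) * ‖a‖ := by
    have := norm_add_le (m - a) a
    rw [sub_add_cancel] at this
    linarith
  have hnm2 : ‖m‖ ^ 2 ≤ (1 + δ) ^ 2 * ‖a‖ ^ 2 := by
    rw [← mul_pow]
    exact pow_le_pow_left₀ (norm_nonneg _) hnm 2
  have hin : (1 - δ) * ‖a‖ ^ 2 ≤ inner ℝ a m := by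
    have h1 := (abs_le.1 (abs_real_inner_le_norm a (m - a))).1
    rw [inner_sub_right, real_inner_self_eq_norm_sq] at h1
    have h2 := mul_le_mul_of_nonneg_left hbias (norm_nonneg a)
    nlinarith
  have e1 : L * γ ^ 2 * (∫ ω, ‖X ω‖ ^ 2 ∂μ₀) ≤ L * γ ^ 2 * (σ ^ 2 + (1 + δ) ^ 2 * ‖a‖ ^ 2) :=
    mul_le_mul_of_nonneg_left (by linarith) (by positivity)
  have e2 := mul_le_mul_of_nonneg_right hγL (show 0 ≤ γ * ‖a‖ ^ 2 by positivity)
  have e3 := mul_le_mul_of_nonneg_left hin (show 0 ≤ 2 * γ by positivity)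
  nlinarith

theorem sgd_core {H : Type*} [NormedAddCommGroup H] [InnerProductSpace ℝ H] [CompleteSpace H]
    (ℒ : H → ℝ) (g : H → H) (L : ℝ) (hL : 0 < L)
    (hgrad : ∀ θ, HasFDerivAt ℒ ((InnerProductSpace.toDualMap ℝ H) (g θ)) θ)
    (hLip : ∀ θ θ', ‖g θ - g θ'‖ ≤ L * ‖θ - θ'‖)
    (δ : ℝ) (hδ : δ ∈ Set.Ico (0 : ℝ) 1) (σ : ℝ)
    {Ω₀ : Type*} [MeasurableSpace Ω₀] (μ₀ : Measure Ω₀) [IsProbabilityMeasure μ₀]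
    (G : H → Ω₀ → H)
    (hG_int : ∀ θ, Integrable (G θ) μ₀)
    (hG_sq : ∀ θ, Integrable (fun ω₀ => ‖G θ ω₀‖ ^ 2) μ₀)
    (hbias : ∀ θ, ‖(∫ ω₀, G θ ω₀ ∂μ₀) - g θ‖ ≤ δ * ‖g θ‖)
    (hvar : ∀ θ, (∫ ω₀, ‖G θ ω₀ - ∫ ω₀', G θ ω₀' ∂μ₀‖ ^ 2 ∂μ₀) ≤ σ ^ 2)
    (N : ℕ) : ∀ (θ₁ : H) (γ : ℕ → ℝ)
    (_ : ∀ n, n < N → 0 < γ n)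
    (_ : ∀ n, n < N → γ n * (L * (1 + δ) ^ 2) ≤ 1 - δ)
    (θseq : ℕ → (Fin N → Ω₀) → H)
    (_ : ∀ ω, θseq 0 ω = θ₁)
    (_ : ∀ n : Fin N, ∀ ω : Fin N → Ω₀,
      θseq (n + 1) ω = θseq n ω - γ n • G (θseq n ω) (ω n))
    (F : (Fin N → Ω₀) → ℝ) (_ : Integrable F (Measure.pi fun _ : Fin N => μ₀)) (A : ℝ)
    (_ : ∀ ω, F ω ≤ A + ∑ n ∈ Finset.range N, (1 - δ) * (γ n * ‖g (θseq n ω)‖ ^ 2)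
      + 2 * ℒ (θseq N ω)),
    ∫ ω, F ω ∂(Measure.pi fun _ : Fin N => μ₀) ≤
      A + 2 * ℒ θ₁ + L * σ ^ 2 * ∑ n ∈ Finset.range N, γ n ^ 2 := by
  induction N with
  | zero =>
    intro θ₁ γ _ _ θseq h0 _ F hF A hFA
    have := integral_mono hF (integrable_const (A + 2 * ℒ θ₁)) (fun ω => by
      have := hFA ω
      rw [h0] at this
      simpa using this)
    simpa using this
  | succ N ih =>
    intro θ₁ γ hγ hγL θseq h0 hstep F hF A hFA
    have hmp := (measurePreserving_piFinSuccAbove (fun _ : Fin (N + 1) => μ₀) 0).symm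
    set e := (MeasurableEquiv.piFinSuccAbove (fun _ : Fin (N + 1) => Ω₀) 0).symm with he
    have hecons : ∀ p : Ω₀ × (Fin N → Ω₀), e p = Fin.cons p.1 p.2 := by
      intro p
      simp [he, MeasurableEquiv.piFinSuccAbove, Fin.insertNthEquiv]
    have hFi : Integrable (fun p => F (e p)) (μ₀.prod (Measure.pi fun _ : Fin N => μ₀)) :=
      (hmp.integrable_comp_emb e.measurableEmbedding).2 hF
    have hFe : ∫ ω, F ω ∂(Measure.pi fun _ : Fin (N + 1) => μ₀) =
        ∫ x, ∫ y, F (e (x, y)) ∂(Measure.pi fun _ : Fin N => μ₀) ∂μ₀ := by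
      rw [← integral_prod _ hFi]
      exact (hmp.integral_comp e.measurableEmbedding F).symm
    rw [hFe]
    obtain ⟨hJ, hJle⟩ := sgd_one_step L δ σ (γ 0) hL hδ μ₀ (G θ₁) (g θ₁) (hG_int _) (hG_sq _)
      (hbias _) (hvar _) (hγ 0 (by omega)) (hγL 0 (by omega))
    set S := ∑ n ∈ Finset.range N, γ (n + 1) ^ 2 with hS
    set B := A + (1 - δ) * (γ 0 * ‖g θ₁‖ ^ 2) + 2 * ℒ θ₁ + L * σ ^ 2 * S with hB
    have hae : ∀ᵐ x ∂μ₀, ∫ y, F (e (x, y)) ∂(Measure.pi fun _ : Fin N => μ₀) ≤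
        B + (- 2 * γ 0 * inner ℝ (g θ₁) (G θ₁ x) + L * γ 0 ^ 2 * ‖G θ₁ x‖ ^ 2) := by
      filter_upwards [hFi.prod_right_ae] with x hx
      have h1 := ih (θ₁ - γ 0 • G θ₁ x) (fun n => γ (n + 1)) (fun n hn => hγ _ (by omega))
        (fun n hn => hγL _ (by omega)) (fun n y => θseq (n + 1) (e (x, y)))
        (fun y => by
          have := hstep 0 (e (x, y))
          simp only [Fin.val_zero, h0, hecons, Fin.cons_zero] at this
          simpa [hecons] using this)
        (fun n y => by
          have := hstep n.succ (e (x, y))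
          simp only [Fin.val_succ, hecons, Fin.cons_succ] at this
          simpa [hecons] using this)
        (fun y => F (e (x, y))) hx (A + (1 - δ) * (γ 0 * ‖g θ₁‖ ^ 2))
        (fun y => by
          have := hFA (e (x, y))
          rw [Finset.sum_range_succ', h0] at this
          linarith)
      have h2 := sgd_descent ℒ g L hgrad hLip θ₁ (-(γ 0 • G θ₁ x))
      rw [← sub_eq_add_neg, inner_neg_right, inner_smul_right, norm_neg, norm_smul, mul_pow,
        Real.norm_eq_abs, sq_abs] at h2
      rw [hB]
      linarith
    have h3 := integral_mono_ae hFi.integral_prod_left ((integrable_const B).add hJ) hae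
    refine h3.trans ?_
    simp only [Pi.add_apply]
    rw [integral_add (integrable_const B) hJ, Finset.sum_range_succ', ← hS]
    simp only [integral_const, probReal_univ, one_smul]
    rw [hB]
    linarith

/-- Theorem 2 (SGD with Biased Gradients): for a loss `ℒ` with `L`-Lipschitz
gradient `g` bounded below by `ℒ*`, and a stochastic gradient oracle `G` with
relative bias bounded by `δ < 1` and variance bounded by `σ²` at every point,
the SGD iterates `θ_{n+1} = θ_n − γ_n·G(θ_n, ω_n)` (with independent noise on
the product space `Ω₀^N` and stepsizes `γ_n ≤ (1−δ)/(L(1+δ)²)`) satisfy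
`E[min_{1 ≤ n ≤ N+1} ‖g(θ_n)‖²] ≤ (2D_ℒ + Lσ²Σγ_n²)/((1−δ)Σγ_n)`. -/
theorem sgd_biased_gradients_convergence
    {H : Type*} [NormedAddCommGroup H] [InnerProductSpace ℝ H]
    [MeasurableSpace H] [BorelSpace H]
    (ℒ : H → ℝ) (g : H → H) (L : ℝ)
    (hgrad : ∀ θ, HasFDerivAt ℒ ((InnerProductSpace.toDualMap ℝ H) (g θ)) θ)
    (hLip : ∀ θ θ', ‖g θ - g θ'‖ ≤ L * ‖θ - θ'‖)
    (lstar : ℝ) (hbelow : ∀ θ, lstar ≤ ℒ θ)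
    (δ : ℝ) (hδ : δ ∈ Set.Ico (0 : ℝ) 1) (σ : ℝ) (hσ : 0 ≤ σ)
    {Ω₀ : Type*} [MeasurableSpace Ω₀] (μ₀ : Measure Ω₀) [IsProbabilityMeasure μ₀]
    (G : H → Ω₀ → H) (hG_meas : Measurable (Function.uncurry G))
    (hG_int : ∀ θ, Integrable (G θ) μ₀)
    (hG_sq : ∀ θ, Integrable (fun ω₀ => ‖G θ ω₀‖ ^ 2) μ₀)
    (hbias : ∀ θ, ‖(∫ ω₀, G θ ω₀ ∂μ₀) - g θ‖ ≤ δ * ‖g θ‖)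
    (hvar : ∀ θ, (∫ ω₀, ‖G θ ω₀ - ∫ ω₀', G θ ω₀' ∂μ₀‖ ^ 2 ∂μ₀) ≤ σ ^ 2)
    (N : ℕ) (hN : 0 < N) (θ₁ : H) (γ : ℕ → ℝ)
    (hγ_pos : ∀ n, 1 ≤ n → n ≤ N → 0 < γ n)
    (hγ_le : ∀ n, 1 ≤ n → n ≤ N → γ n ≤ (1 - δ) / (L * (1 + δ) ^ 2))
    (θseq : ℕ → (Fin N → Ω₀) → H)
    (hθ_init : ∀ ω, θseq 1 ω = θ₁)
    (hθ_step : ∀ n (h1 : 1 ≤ n) (h2 : n ≤ N), ∀ ω : Fin N → Ω₀,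
      θseq (n + 1) ω = θseq n ω - γ n • G (θseq n ω) (ω ⟨n - 1, by omega⟩)) :
    (∫ ω, ((Finset.Icc 1 (N + 1)).inf' (Finset.nonempty_Icc.mpr (by omega))
        fun n => ‖g (θseq n ω)‖ ^ 2) ∂(Measure.pi fun _ : Fin N => μ₀)) ≤
      (2 * (ℒ θ₁ - lstar) + L * σ ^ 2 * ∑ n ∈ Finset.Icc 1 N, γ n ^ 2) /
        ((1 - δ) * ∑ n ∈ Finset.Icc 1 N, γ n) := by
  have hδ' := hδ
  obtain ⟨hδ0, hδ1⟩ := hδ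
  have hL : 0 < L := by
    have h1 := (hγ_pos 1 le_rfl hN).trans_le (hγ_le 1 le_rfl hN)
    by_contra hL
    have : (1 - δ) / (L * (1 + δ) ^ 2) ≤ 0 :=
      div_nonpos_of_nonneg_of_nonpos (by linarith)
        (mul_nonpos_of_nonpos_of_nonneg (not_lt.1 hL) (by positivity))
    linarith
  have hS : 0 < ∑ n ∈ Finset.Icc 1 N, γ n := by
    apply Finset.sum_pos
    · intro n hn
      rw [Finset.mem_Icc] at hn
      exact hγ_pos n hn.1 hn.2
    · exact Finset.nonempty_Icc.mpr hN
  have hcS : 0 < (1 - δ) * ∑ n ∈ Finset.Icc 1 N, γ n := mul_pos (by linarith) hS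
  have hR : 0 ≤ (2 * (ℒ θ₁ - lstar) + L * σ ^ 2 * ∑ n ∈ Finset.Icc 1 N, γ n ^ 2) /
        ((1 - δ) * ∑ n ∈ Finset.Icc 1 N, γ n) := by
    have := hbelow θ₁
    have h2 : 0 ≤ ∑ n ∈ Finset.Icc 1 N, γ n ^ 2 := Finset.sum_nonneg fun n _ => sq_nonneg _
    apply div_nonneg _ hcS.le
    have : 0 ≤ L * σ ^ 2 * ∑ n ∈ Finset.Icc 1 N, γ n ^ 2 := by positivity
    linarith
  set F : (Fin N → Ω₀) → ℝ := fun ω =>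
    (Finset.Icc 1 (N + 1)).inf' (Finset.nonempty_Icc.mpr (by omega))
        fun n => ‖g (θseq n ω)‖ ^ 2 with hFdef
  by_cases hF : Integrable F (Measure.pi fun _ : Fin N => μ₀)
  swap
  · rw [integral_undef hF]
    exact hR
  by_cases hc : CompleteSpace H
  swap
  · have hg : ∀ θ, g θ = 0 := by
      intro θ
      have h1 := hbias θ
      have h2 : (∫ ω₀, G θ ω₀ ∂μ₀) = 0 := by simp [integral, hc]
      rw [h2, zero_sub, norm_neg] at h1
      have h3 := norm_nonneg (g θ)
      have : ‖g θ‖ = 0 := by nlinarith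
      exact norm_eq_zero.1 this
    have hF0 : ∀ ω, F ω = 0 := by
      intro ω
      simp [hFdef, hg]
    rw [show F = fun _ => 0 from funext hF0, integral_zero]
    exact hR
  have hsum : ∀ f : ℕ → ℝ, ∑ n ∈ Finset.range N, f (n + 1) = ∑ n ∈ Finset.Icc 1 N, f n := by
    intro f
    rw [Finset.range_eq_Ico, Finset.sum_Ico_add' f 0 N 1]
    rfl
  have key := sgd_core ℒ g L hL hgrad hLip δ hδ' σ μ₀ G hG_int hG_sq hbias hvar N θ₁
    (fun n => γ (n + 1)) (fun n hn => hγ_pos _ (by omega) (by omega))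
    (fun n hn => (le_div_iff₀ (by positivity)).1 (hγ_le _ (by omega) (by omega)))
    (fun n => θseq (n + 1)) hθ_init
    (fun n ω => hθ_step (n + 1) (by omega) (by omega) ω)
    (fun ω => ((1 - δ) * ∑ n ∈ Finset.Icc 1 N, γ n) * F ω) (hF.const_mul _) (-2 * lstar)
    (fun ω => by
      have h1 := hbelow (θseq (N + 1) ω)
      rw [hsum (fun n => (1 - δ) * (γ n * ‖g (θseq n ω)‖ ^ 2)), mul_assoc, Finset.sum_mul,
        Finset.mul_sum]
      have h2 : ∑ n ∈ Finset.Icc 1 N, (1 - δ) * (γ n * F ω) ≤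
          ∑ n ∈ Finset.Icc 1 N, (1 - δ) * (γ n * ‖g (θseq n ω)‖ ^ 2) := by
        apply Finset.sum_le_sum
        intro n hn
        rw [Finset.mem_Icc] at hn
        apply mul_le_mul_of_nonneg_left _ (by linarith)
        apply mul_le_mul_of_nonneg_left _ (hγ_pos n hn.1 hn.2).le
        exact Finset.inf'_le (fun n => ‖g (θseq n ω)‖ ^ 2)
          (Finset.mem_Icc.2 ⟨hn.1, by omega⟩)
      linarith)
  rw [hsum (fun n => γ n ^ 2), integral_const_mul] at key
  rw [le_div_iff₀ hcS]
  linarith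
end
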